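/- Let n ≥ 1 and let λ : Fin n → ℝ satisfy λᵢ > 0 for all i. Then Σᵢ λᵢ ≤ (Πᵢ λᵢ) · (Σᵢ 1/λᵢ)^(n−1). -/

import Mathlib

theorem Finset.one_le_prod_mul_sum_inv_pow_card {ι : Type*} (s : Finset ι) (f : ι → ℝ)
    (hf : ∀ i ∈ s, 0 < f i) : 1 ≤ (∏ i ∈ s, f i) * (∑ i ∈ s, (f i)⁻¹) ^ s.card := by
  have h : ∏ i ∈ s, (f i)⁻¹ ≤ ∏ _i ∈ s, ∑ j ∈ s, (f j)⁻¹ :=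
    Finset.prod_le_prod (fun i hi => (inv_pos.2 (hf i hi)).le) fun i hi =>
      Finset.single_le_sum (f := fun j => (f j)⁻¹) (fun j hj => (inv_pos.2 (hf j hj)).le) hi
  rw [Finset.prod_const, Finset.prod_inv_distrib] at h
  exact (inv_le_iff_one_le_mul₀' (Finset.prod_pos hf)).1 h

theorem Finset.sum_le_prod_mul_sum_inv_pow {ι : Type*} {s : Finset ι} (hs : s.Nonempty)
    (f : ι → ℝ) (hf : ∀ i ∈ s, 0 < f i) :
    ∑ i ∈ s, f i ≤ (∏ i ∈ s, f i) * (∑ i ∈ s, (f i)⁻¹) ^ (s.card - 1) := by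
  induction hs using Finset.Nonempty.cons_induction with
  | singleton a => simp
  | cons a s ha hs ih =>
    have hfs : ∀ i ∈ s, 0 < f i := fun i hi => hf i (Finset.mem_cons_of_mem hi)
    have hfa : 0 < f a := hf a (Finset.mem_cons_self a s)
    have hone := Finset.one_le_prod_mul_sum_inv_pow_card s f hfs
    have hP : 0 < ∏ i ∈ s, f i := Finset.prod_pos hfs
    have hS : 0 < ∑ i ∈ s, (f i)⁻¹ := Finset.sum_pos (fun i hi => inv_pos.2 (hfs i hi)) hs
    specialize ih hfs
    obtain ⟨k, hk⟩ := Nat.exists_eq_succ_of_ne_zero hs.card_ne_zero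
    rw [Finset.sum_cons, Finset.prod_cons, Finset.sum_cons, Finset.card_cons,
      Nat.add_sub_cancel]
    rw [hk, Nat.succ_sub_one] at ih
    rw [hk, Nat.succ_eq_add_one] at hone ⊢
    set P := ∏ i ∈ s, f i
    set S := ∑ i ∈ s, (f i)⁻¹
    calc f a + ∑ i ∈ s, f i ≤ f a * (P * S ^ (k + 1)) + P * S ^ k :=
          add_le_add (le_mul_of_one_le_right hfa.le hone) ih
      _ = f a * P * (S ^ k * ((f a)⁻¹ + S)) := by field_simp; ring
      _ ≤ f a * P * (((f a)⁻¹ + S) ^ k * ((f a)⁻¹ + S)) := by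
          gcongr
          exact le_add_of_nonneg_left (inv_pos.2 hfa).le
      _ = f a * P * ((f a)⁻¹ + S) ^ (k + 1) := by rw [pow_succ]

theorem stmt_14 (n : ℕ) (hn : 1 ≤ n) (lam : Fin n → ℝ) (hlam : ∀ i, 0 < lam i) :
    ∑ i, lam i ≤ (∏ i, lam i) * (∑ i, (lam i)⁻¹) ^ (n - 1) := by
  have : Nonempty (Fin n) := ⟨⟨0, hn⟩⟩
  simpa using Finset.sum_le_prod_mul_sum_inv_pow Finset.univ_nonempty lam fun i _ => hlam i
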